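/- Let β be a Sturmian sequence on the alphabet {0,1}. Then for every odd k ≥ 1, β has exactly one palindromic factor of length k whose central letter is 0 and exactly one palindromic factor of length k whose central letter is 1. -/

import Mathlib

namespace PalPaper

variable {α : Type*}

/-- The finite word `u i, u (i+1), …, u (i+k-1)` read off the infinite sequence `u`. -/
def factorAt (u : ℕ → α) (i k : ℕ) : List α :=
  (List.range k).map fun j => u (i + j)

/-- `w` occurs as a contiguous block (factor) in the infinite sequence `u`. -/
def IsFactor (u : ℕ → α) (w : List α) : Prop :=
  ∃ i, w = factorAt u i w.length

/-- A palindrome is a word equal to its reversal. -/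
def IsPalindrome (w : List α) : Prop := w.reverse = w

/-- Number of distinct factors of length `k` of `u`. -/
noncomputable def facComplexity (u : ℕ → α) (k : ℕ) : ℕ :=
  Set.ncard {w : List α | w.length = k ∧ IsFactor u w}

/-- Number of distinct palindromic factors of length `k` of `u`. -/
noncomputable def palComplexity (u : ℕ → α) (k : ℕ) : ℕ :=
  Set.ncard {w : List α | w.length = k ∧ IsFactor u w ∧ IsPalindrome w}

/-- `p ≥ 1` is a period of the finite word `w`. -/
def IsPeriodOf (p : ℕ) (w : List α) : Prop :=
  1 ≤ p ∧ ∀ i (h : i + p < w.length), w[i]'(by omega) = w[i + p]'h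

/-- The minimal period of a finite word. -/
noncomputable def minPeriod (w : List α) : ℕ := sInf {p | IsPeriodOf p w}

/-- The prefix of length `m` of the infinite sequence `u`, as a finite word. -/
def seqPrefix (u : ℕ → α) (m : ℕ) : List α := (List.range m).map u

/-- The word `σ(u 0) σ(u 1) ⋯ σ(u (n-1))`. -/
def substPrefix (σ : α → List α) (u : ℕ → α) (n : ℕ) : List α :=
  (List.range n).flatMap fun i => σ (u i)

/-- `v = σ(u)`: every word `σ(u 0) ⋯ σ(u (n-1))` is the corresponding prefix of `v`. -/
def IsMorphicImage (σ : α → List α) (u v : ℕ → α) : Prop :=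
  ∀ n, substPrefix σ u n = seqPrefix v (substPrefix σ u n).length

/-- `u` is a fixed point of the morphism `σ`, i.e. `σ(u) = u`. -/
def IsFixedPointOf (σ : α → List α) (u : ℕ → α) : Prop := IsMorphicImage σ u u

/-- The `k`-th iterate of a morphism, applied to a letter. -/
def morphIter (σ : α → List α) : ℕ → α → List α
  | 0, a => [a]
  | k + 1, a => (σ a).flatMap (morphIter σ k)

/-- A morphism is primitive if some iterate maps every letter to a word
containing every letter. -/
def IsPrimitive (σ : α → List α) : Prop :=
  ∃ k, 1 ≤ k ∧ ∀ a b : α, b ∈ morphIter σ k a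

section Words

variable {u : ℕ → α} {w : List α}

@[simp] theorem length_factorAt (u : ℕ → α) (i k : ℕ) : (factorAt u i k).length = k := by
  simp [factorAt]

theorem factorAt_succ (u : ℕ → α) (i k : ℕ) :
    factorAt u i (k + 1) = factorAt u i k ++ [u (i + k)] := by
  simp [factorAt, List.range_succ]

theorem factorAt_succ' (u : ℕ → α) (i k : ℕ) :
    factorAt u i (k + 1) = u i :: factorAt u (i + 1) k := by
  simp [factorAt, List.range_succ_eq_map, Function.comp_def, Nat.add_assoc, Nat.add_comm 1]

theorem factorAt_getElem (u : ℕ → α) (i k l : ℕ) (h : l < (factorAt u i k).length) :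
    (factorAt u i k)[l] = u (i + l) := by
  simp [factorAt]

theorem isFactor_factorAt (u : ℕ → α) (i k : ℕ) : IsFactor u (factorAt u i k) :=
  ⟨i, by simp⟩

theorem IsFactor.of_cons {a : α} (h : IsFactor u (a :: w)) : IsFactor u w := by
  obtain ⟨i, hi⟩ := h
  rw [List.length_cons, factorAt_succ'] at hi
  exact ⟨i + 1, (List.cons.inj hi).2⟩

theorem IsFactor.of_append_singleton {a : α} (h : IsFactor u (w ++ [a])) : IsFactor u w := by
  obtain ⟨i, hi⟩ := h
  rw [List.length_append, List.length_singleton, factorAt_succ] at hi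
  exact ⟨i, (List.append_inj' hi rfl).1⟩

theorem IsFactor.exists_append_singleton (h : IsFactor u w) : ∃ a, IsFactor u (w ++ [a]) := by
  obtain ⟨i, hi⟩ := h
  refine ⟨u (i + w.length), i, ?_⟩
  rw [List.length_append, List.length_singleton, factorAt_succ, ← hi]

theorem factors_finite [Finite α] (u : ℕ → α) (k : ℕ) :
    {w : List α | w.length = k ∧ IsFactor u w}.Finite :=
  (List.finite_length_eq α k).subset fun _ h => h.1

theorem facComplexity_zero (u : ℕ → α) : facComplexity u 0 = 1 := by
  rw [facComplexity, Set.ncard_eq_one]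
  refine ⟨[], Set.eq_singleton_iff_unique_mem.2 ⟨⟨rfl, isFactor_factorAt u 0 0⟩, ?_⟩⟩
  exact fun w h => List.length_eq_zero_iff.1 h.1

/-- An eventually periodic sequence has bounded complexity. -/
theorem facComplexity_le_of_eventually_periodic {N d : ℕ} (hd : 0 < d)
    (h : ∀ t, N ≤ t → u (t + d) = u t) (k : ℕ) : facComplexity u k ≤ N + d := by
  have hsub : {w : List α | w.length = k ∧ IsFactor u w} ⊆
      ((fun t => factorAt u t k) '' (Finset.range (N + d) : Set ℕ)) := by
    rintro w ⟨rfl, i, hi⟩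
    rw [hi, length_factorAt]
    clear hi
    generalize w.length = k
    induction i using Nat.strong_induction_on with
    | _ i ih =>
      by_cases hlt : i < N + d
      · exact ⟨i, by simpa using hlt, rfl⟩
      · have heq : factorAt u i k = factorAt u (i - d) k := by
          refine List.map_congr_left fun j _ => ?_
          rw [← h (i - d + j) (by omega)]
          congr 1
          omega
        rw [heq]
        exact ih (i - d) (by omega)
  calc facComplexity u k
      ≤ ((fun t => factorAt u t k) '' (Finset.range (N + d) : Set ℕ)).ncard :=
        Set.ncard_le_ncard hsub ((Finset.finite_toSet _).image _)
    _ ≤ (Finset.range (N + d) : Set ℕ).ncard := Set.ncard_image_le (Finset.finite_toSet _)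
    _ = N + d := by rw [Set.ncard_coe_finset, Finset.card_range]

/-- Dropping the first letter of a sequence loses at most one factor of each length. -/
theorem facComplexity_le_shift [Finite α] (u : ℕ → α) (k : ℕ) :
    facComplexity u k ≤ facComplexity (fun i => u (i + 1)) k + 1 := by
  refine (Set.ncard_le_ncard (t := insert (factorAt u 0 k) _) ?_
    ((factors_finite _ k).insert _)).trans (Set.ncard_insert_le _ _)
  rintro w ⟨rfl, i, hi⟩
  rcases i with _ | i
  · exact Or.inl hi
  · refine Or.inr ⟨rfl, i, hi.trans ?_⟩
    simp [factorAt, Nat.add_right_comm]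

end Words

section Binary

variable {u : ℕ → Fin 2} {w : List (Fin 2)}

/-- A word is right special if each of its two right extensions is a factor. -/
def IsRightSpecial (u : ℕ → Fin 2) (w : List (Fin 2)) : Prop :=
  ∀ c, IsFactor u (w ++ [c])

theorem forall_of_ne {P : Fin 2 → Prop} {a b : Fin 2} (hab : a ≠ b) (ha : P a) (hb : P b)
    (c : Fin 2) : P c := by
  have : c = a ∨ c = b := by omega
  rcases this with rfl | rfl <;> assumption

theorem IsRightSpecial.isFactor (h : IsRightSpecial u w) : IsFactor u w :=
  (h 0).of_append_singleton

theorem IsRightSpecial.of_cons {a : Fin 2} (h : IsRightSpecial u (a :: w)) :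
    IsRightSpecial u w :=
  fun c => (h c).of_cons

theorem facComplexity_succ (u : ℕ → Fin 2) (n : ℕ) :
    facComplexity u (n + 1) =
      facComplexity u n + {w | w.length = n ∧ IsRightSpecial u w}.ncard := by
  let E : Fin 2 → Set (List (Fin 2)) := fun c => {w | w.length = n ∧ IsFactor u (w ++ [c])}
  have hE : ∀ c, (E c).Finite := fun c => (List.finite_length_eq _ n).subset fun _ h => h.1
  have hunion : E 0 ∪ E 1 = {w | w.length = n ∧ IsFactor u w} := by
    ext w
    constructor
    · rintro (h | h) <;> exact ⟨h.1, h.2.of_append_singleton⟩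
    · rintro ⟨h, hw⟩
      obtain ⟨a, ha⟩ := hw.exists_append_singleton
      fin_cases a
      · exact Or.inl ⟨h, ha⟩
      · exact Or.inr ⟨h, ha⟩
  have hinter : E 0 ∩ E 1 = {w | w.length = n ∧ IsRightSpecial u w} := by
    ext w
    constructor
    · rintro ⟨h, h'⟩
      exact ⟨h.1, forall_of_ne zero_ne_one h.2 h'.2⟩
    · rintro ⟨h, hw⟩
      exact ⟨⟨h, hw 0⟩, ⟨h, hw 1⟩⟩
  have hinj : ∀ c : Fin 2, Function.Injective fun w : List (Fin 2) => w ++ [c] :=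
    fun c _ _ h => List.append_cancel_right h
  have hext : {w | w.length = n + 1 ∧ IsFactor u w} =
      (fun w => w ++ [0]) '' E 0 ∪ (fun w => w ++ [1]) '' E 1 := by
    ext w
    constructor
    · rintro ⟨h, hw⟩
      obtain rfl | ⟨v, a, rfl⟩ := w.eq_nil_or_concat'
      · simp at h
      · have hv : v.length = n := by simpa using h
        fin_cases a
        · exact Or.inl ⟨v, ⟨hv, hw⟩, rfl⟩
        · exact Or.inr ⟨v, ⟨hv, hw⟩, rfl⟩
    · rintro (⟨v, ⟨hv, hw⟩, rfl⟩ | ⟨v, ⟨hv, hw⟩, rfl⟩) <;> exact ⟨by simp [hv], hw⟩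
  have hdisj : Disjoint ((fun w => w ++ [0]) '' E 0) ((fun w => w ++ [1]) '' E 1) := by
    rw [Set.disjoint_left]
    rintro _ ⟨v, _, rfl⟩ ⟨v', _, h⟩
    have := (List.append_inj' h rfl).2
    simp at this
  rw [facComplexity, facComplexity, hext,
    Set.ncard_union_eq hdisj ((hE 0).image _) ((hE 1).image _),
    Set.ncard_image_of_injective _ (hinj 0), Set.ncard_image_of_injective _ (hinj 1),
    ← hunion, ← hinter, Set.ncard_union_add_ncard_inter _ _ (hE 0) (hE 1)]

theorem next_eq_of_not_isRightSpecial {n i j : ℕ} (h : factorAt u i n = factorAt u j n)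
    (hrs : ¬ IsRightSpecial u (factorAt u i n)) : u (i + n) = u (j + n) := by
  by_contra hne
  refine hrs (forall_of_ne hne ?_ ?_)
  · rw [← factorAt_succ]
    exact isFactor_factorAt ..
  · rw [h, ← factorAt_succ]
    exact isFactor_factorAt ..

theorem factorAt_add_one_eq {n i j : ℕ} (h : factorAt u i n = factorAt u j n)
    (hrs : ¬ IsRightSpecial u (factorAt u i n)) :
    factorAt u (i + 1) n = factorAt u (j + 1) n := by
  have hs : factorAt u i (n + 1) = factorAt u j (n + 1) := by
    rw [factorAt_succ, factorAt_succ, next_eq_of_not_isRightSpecial h hrs, h]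
  rw [factorAt_succ', factorAt_succ'] at hs
  exact (List.cons.inj hs).2

/-- If a factor reappears and no right special factor of the same length occurs in between,
then the sequence has bounded complexity. -/
theorem exists_facComplexity_le_of_repeat {n i j : ℕ} (hij : i < j)
    (h : factorAt u i n = factorAt u j n)
    (hrs : ∀ t, i ≤ t → t < j → ¬ IsRightSpecial u (factorAt u t n)) :
    ∃ B, ∀ k, facComplexity u k ≤ B := by
  obtain ⟨d, rfl⟩ := Nat.exists_eq_add_of_lt hij
  have key : ∀ s, factorAt u (i + s) n = factorAt u (i + s + (d + 1)) n ∧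
      ¬ IsRightSpecial u (factorAt u (i + s) n) := by
    intro s
    induction s using Nat.strong_induction_on with
    | _ s ih =>
      constructor
      · rcases s with _ | s
        · exact h
        · have := ih s (by omega)
          have hs := factorAt_add_one_eq this.1 this.2
          rwa [show i + s + (d + 1) + 1 = i + (s + 1) + (d + 1) by omega] at hs
      · by_cases hs : s < d + 1
        · exact hrs _ (by omega) (by omega)
        · have := ih (s - (d + 1)) (by omega)
          rw [show i + s = i + (s - (d + 1)) + (d + 1) by omega, ← this.1]
          exact this.2
  refine ⟨_, facComplexity_le_of_eventually_periodic (N := i + n) (Nat.succ_pos d) ?_⟩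
  intro t ht
  have := key (t - (i + n))
  have hnext := next_eq_of_not_isRightSpecial this.1 this.2
  rw [show i + (t - (i + n)) + n = t by omega,
    show i + (t - (i + n)) + (d + 1) + n = t + (d + 1) by omega] at hnext
  exact hnext.symm

/-- Morse–Hedlund: a sequence with at most `n` factors of some length `n` has bounded
complexity. -/
theorem exists_facComplexity_le_of_le {n : ℕ} (h : facComplexity u n ≤ n) :
    ∃ B, ∀ k, facComplexity u k ≤ B := by
  obtain ⟨k, hk⟩ : ∃ k, facComplexity u (k + 1) ≤ facComplexity u k := by
    by_contra! hlt
    have : ∀ k, k + 1 ≤ facComplexity u k := by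
      intro k
      induction k with
      | zero => rw [facComplexity_zero]
      | succ k ih => have := hlt k; omega
    have := this n
    omega
  have hfin : {w | w.length = k ∧ IsRightSpecial u w}.Finite :=
    (List.finite_length_eq _ k).subset fun _ h => h.1
  have hempty : {w | w.length = k ∧ IsRightSpecial u w} = ∅ := by
    rw [← Set.ncard_eq_zero hfin]
    have := facComplexity_succ u k
    omega
  obtain ⟨i, -, j, -, hne, heq⟩ := Set.infinite_univ.exists_ne_map_eq_of_mapsTo
    (f := fun t => factorAt u t k) (t := {w | w.length = k ∧ IsFactor u w})
    (fun t _ => ⟨length_factorAt u t k, isFactor_factorAt u t k⟩) (factors_finite u k)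
  have hrs : ∀ t, ¬ IsRightSpecial u (factorAt u t k) := fun t ht =>
    (Set.ext_iff.1 hempty _).1 ⟨length_factorAt u t k, ht⟩
  rcases hne.lt_or_gt with hlt | hlt
  · exact exists_facComplexity_le_of_repeat hlt heq fun t _ _ => hrs t
  · exact exists_facComplexity_le_of_repeat hlt heq.symm fun t _ _ => hrs t

end Binary

section Sturmian

variable {u : ℕ → Fin 2} {v w : List (Fin 2)}

/-- A binary sequence is Sturmian if it has `k + 1` factors of each length `k ≥ 1`. -/
def IsSturmian (u : ℕ → Fin 2) : Prop := ∀ k, 1 ≤ k → facComplexity u k = k + 1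

namespace IsSturmian

theorem facComplexity_eq (h : IsSturmian u) (k : ℕ) : facComplexity u k = k + 1 := by
  rcases k with _ | k
  · exact facComplexity_zero u
  · exact h _ (Nat.succ_pos k)

theorem not_bounded (h : IsSturmian u) : ¬ ∃ B, ∀ k, facComplexity u k ≤ B := by
  rintro ⟨B, hB⟩
  have := hB B
  rw [h.facComplexity_eq] at this
  omega

theorem exists_cons (h : IsSturmian u) (hw : IsFactor u w) : ∃ a, IsFactor u (a :: w) := by
  by_contra! hno
  have hshift : facComplexity (fun i => u (i + 1)) w.length ≤ w.length := by
    have hlt : facComplexity (fun i => u (i + 1)) w.length < facComplexity u w.length := by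
      refine Set.ncard_lt_ncard ?_ (factors_finite u _)
      have hfac : ∀ x, IsFactor (fun i => u (i + 1)) x → ∃ a, IsFactor u (a :: x) := by
        rintro x ⟨i, hi⟩
        refine ⟨u i, i, ?_⟩
        rw [List.length_cons, factorAt_succ']
        congr 1
        refine hi.trans ?_
        simp [factorAt, Nat.add_right_comm]
      refine (Set.ssubset_iff_of_subset ?_).2 ⟨w, ⟨rfl, hw⟩, ?_⟩
      · rintro x ⟨hx, hxf⟩
        exact ⟨hx, (hfac x hxf).elim fun _ ha => ha.of_cons⟩
      · rintro ⟨-, hxf⟩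
        exact (hfac w hxf).elim hno
    rw [h.facComplexity_eq] at hlt
    omega
  obtain ⟨B, hB⟩ := exists_facComplexity_le_of_le hshift
  exact h.not_bounded ⟨B + 1, fun k => (facComplexity_le_shift u k).trans (by simpa using hB k)⟩

theorem ncard_rightSpecial (h : IsSturmian u) (n : ℕ) :
    {w | w.length = n ∧ IsRightSpecial u w}.ncard = 1 := by
  have := facComplexity_succ u n
  rw [h.facComplexity_eq, h.facComplexity_eq] at this
  omega

theorem exists_isRightSpecial (h : IsSturmian u) (n : ℕ) :
    ∃ r, r.length = n ∧ IsRightSpecial u r := by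
  obtain ⟨r, hr⟩ := Set.ncard_eq_one.1 (h.ncard_rightSpecial n)
  exact ⟨r, (Set.ext_iff.1 hr r).2 rfl⟩

theorem eq_of_isRightSpecial (h : IsSturmian u) (hv : IsRightSpecial u v)
    (hw : IsRightSpecial u w) (hlen : v.length = w.length) : v = w := by
  obtain ⟨r, hr⟩ := Set.ncard_eq_one.1 (h.ncard_rightSpecial w.length)
  exact ((Set.ext_iff.1 hr v).1 ⟨hlen, hv⟩).trans ((Set.ext_iff.1 hr w).1 ⟨rfl, hw⟩).symm

/-- A right special factor has a right special left extension. -/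
theorem exists_isRightSpecial_cons (h : IsSturmian u) (hw : IsRightSpecial u w) :
    ∃ a, IsRightSpecial u (a :: w) := by
  obtain ⟨_ | ⟨a, r⟩, hlen, hr⟩ := h.exists_isRightSpecial (w.length + 1)
  · simp at hlen
  · rw [h.eq_of_isRightSpecial hw hr.of_cons (by simpa using hlen.symm)]
    exact ⟨a, hr⟩

/-- If `dwd` is a factor with `w` a palindrome and `c ≠ d`, then `cw` is not right special. -/
theorem not_isRightSpecial_cons (h : IsSturmian u) (hw : IsPalindrome w) {c d : Fin 2}
    (hcd : c ≠ d) (hd : IsFactor u (d :: w ++ [d])) : ¬ IsRightSpecial u (c :: w) := by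
  intro hrs
  obtain ⟨i, hi⟩ := hd
  have hlen : (d :: w ++ [d]).length = w.length + 1 + 1 := by simp
  rw [hlen, factorAt_succ] at hi
  obtain ⟨hi, hlast⟩ := List.append_inj' hi rfl
  rw [factorAt_succ'] at hi
  obtain ⟨hfirst, hi⟩ := List.cons.inj hi
  replace hlast : d = u (i + (w.length + 1)) := by simpa using hlast
  have hmid : ∀ k (hk : k < w.length), w[k] = u (i + 1 + k) := by
    intro k hk
    rw [List.getElem_of_eq hi hk, factorAt_getElem]
  have havoid : ∀ s, s ≤ w.length + 1 → factorAt u (i + s) (w.length + 1) ≠ c :: w := by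
    intro s hs heq
    rw [factorAt_succ'] at heq
    obtain ⟨hc, ht⟩ := List.cons.inj heq
    rcases s with _ | s
    · exact hcd (hc.symm.trans hfirst.symm)
    · by_cases hlt : s < w.length
      · have h1 := hmid s hlt
        have hk : w.length - 1 - s < w.length := by omega
        have h2 : w[w.length - 1 - s] = u (i + (s + 1) + 1 + (w.length - 1 - s)) := by
          rw [List.getElem_of_eq ht.symm hk, factorAt_getElem]
        have hpal : w[s] = w[w.length - 1 - s] := by
          rw [List.getElem_of_eq hw.symm hlt, List.getElem_reverse]
        rw [hpal, h2, show i + (s + 1) + 1 + (w.length - 1 - s) = i + (w.length + 1) by omega,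
          ← hlast, show i + 1 + s = i + (s + 1) by omega, hc] at h1
        exact hcd h1.symm
      · obtain rfl : s = w.length := by omega
        exact hcd (hc.symm.trans hlast.symm)
  have hnrs : ∀ s, s ≤ w.length + 1 →
      ¬ IsRightSpecial u (factorAt u (i + s) (w.length + 1)) := fun s hs hr =>
    havoid s hs (h.eq_of_isRightSpecial hr hrs (by simp))
  have hfin := factors_finite u (w.length + 1)
  have hmem : c :: w ∈ {x | x.length = w.length + 1 ∧ IsFactor u x} := ⟨by simp, hrs.isFactor⟩
  obtain ⟨s, hs, t, ht, hne, heq⟩ := Set.exists_ne_map_eq_of_ncard_lt_of_maps_to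
    (s := (Finset.range (w.length + 2) : Set ℕ))
    (t := {x | x.length = w.length + 1 ∧ IsFactor u x} \ {c :: w})
    (by
      rw [Set.ncard_coe_finset, Finset.card_range,
        Set.ncard_sdiff_singleton_of_mem hmem]
      have := h.facComplexity_eq (w.length + 1)
      rw [facComplexity] at this
      omega)
    (f := fun s => factorAt u (i + s) (w.length + 1))
    (fun s hs => ⟨⟨by simp, isFactor_factorAt ..⟩, havoid s (by simp at hs; omega)⟩)
    (hfin.subset Set.sdiff_subset)
  simp only [Finset.coe_range, Set.mem_Iio] at hs ht
  have hrep : ∀ s t, s < t → t < w.length + 2 →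
      factorAt u (i + s) (w.length + 1) ≠ factorAt u (i + t) (w.length + 1) := by
    intro s t hst ht heq
    refine h.not_bounded (exists_facComplexity_le_of_repeat (Nat.add_lt_add_left hst i) heq ?_)
    intro x hx hx'
    rw [show x = i + (x - i) by omega]
    exact hnrs _ (by omega)
  rcases hne.lt_or_gt with hlt | hlt
  · exact hrep s t hlt ht heq
  · exact hrep t s hlt hs heq.symm

/-- A palindrome cannot be surrounded by both letters in a Sturmian sequence. -/
theorem eq_of_isFactor_surround (h : IsSturmian u) (hw : IsPalindrome w) {c d : Fin 2}
    (hc : IsFactor u (c :: w ++ [c])) (hd : IsFactor u (d :: w ++ [d])) : c = d := by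
  by_contra hcd
  have hrs : IsRightSpecial u w :=
    forall_of_ne hcd (List.cons_append ▸ hc).of_cons (List.cons_append ▸ hd).of_cons
  obtain ⟨a, ha⟩ := h.exists_isRightSpecial_cons hrs
  have hac : a = c ∨ a = d := by omega
  rcases hac with rfl | rfl
  · exact h.not_isRightSpecial_cons hw hcd hd ha
  · exact h.not_isRightSpecial_cons hw (Ne.symm hcd) hc ha

/-- The set of factors of a Sturmian sequence is closed under reversal. -/
theorem isFactor_reverse (h : IsSturmian u) (hw : IsFactor u w) : IsFactor u w.reverse := by
  induction hn : w.length using Nat.strong_induction_on generalizing w with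
  | _ n ih =>
    rcases w with _ | ⟨a, w⟩
    · exact hw
    obtain rfl | ⟨v, b, rfl⟩ := w.eq_nil_or_concat'
    · exact hw
    have hav : IsFactor u (v.reverse ++ [a]) := by
      simpa using ih (v.length + 1) (by simp at hn; omega)
        (IsFactor.of_append_singleton (w := a :: v) hw) rfl
    have hvb : IsFactor u (b :: v.reverse) := by
      simpa using ih (v.length + 1) (by simp at hn; omega) hw.of_cons (by simp)
    obtain ⟨c, hc⟩ := hvb.exists_append_singleton
    obtain ⟨d, hd⟩ := h.exists_cons hav
    have hgoal : (a :: (v ++ [b])).reverse = b :: v.reverse ++ [a] := by simp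
    rw [hgoal]
    by_cases hca : c = a
    · rwa [hca] at hc
    by_cases hdb : d = b
    · rwa [hdb] at hd
    have hrs : IsRightSpecial u v.reverse := forall_of_ne hca hc.of_cons hav
    have hdv : IsFactor u (v ++ [d]) := by
      have := ih (v.length + 1) (by simp at hn; omega)
        (IsFactor.of_append_singleton (w := d :: v.reverse) hd) (by simp)
      simpa using this
    have hrs' : IsRightSpecial u v := forall_of_ne hdb hdv hw.of_cons
    have hpal : v.reverse = v := h.eq_of_isRightSpecial hrs hrs' (by simp)
    rw [hpal] at hc hd ⊢
    by_cases hab : a = b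
    · subst hab
      exact hw
    · obtain rfl : c = b := by omega
      obtain rfl : d = a := by omega
      exact absurd (h.eq_of_isFactor_surround hpal hd hc) hab

/-- Every palindromic factor of a Sturmian sequence extends to a longer one, with the same
centre. -/
theorem exists_surround (h : IsSturmian u) (hw : IsPalindrome w) (hf : IsFactor u w) :
    ∃ c, IsFactor u (c :: w ++ [c]) := by
  obtain ⟨c, hc⟩ := hf.exists_append_singleton
  have hcw : IsFactor u (c :: w) := by
    have := h.isFactor_reverse hc
    rwa [List.reverse_append, hw] at this
  obtain ⟨d, hd⟩ := hcw.exists_append_singleton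
  by_cases hdc : d = c
  · exact ⟨c, hdc ▸ hd⟩
  · obtain ⟨a, ha⟩ := h.exists_isRightSpecial_cons (forall_of_ne hdc hd.of_cons hc)
    exact ⟨a, ha a⟩

theorem isFactor_singleton (h : IsSturmian u) (c : Fin 2) : IsFactor u [c] := by
  obtain ⟨r, hr, hrs⟩ := h.exists_isRightSpecial 0
  rw [List.length_eq_zero_iff.1 hr] at hrs
  exact hrs c

/-- For each letter there is exactly one palindromic factor of each odd length centred at it. -/
theorem existsUnique_palindrome (h : IsSturmian u) (a : Fin 2) (m : ℕ) :
    ∃! p : List (Fin 2), p.length = 2 * m + 1 ∧ IsFactor u p ∧ IsPalindrome p ∧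
      p.getD m 0 = a := by
  induction m with
  | zero =>
    refine ⟨[a], ⟨rfl, h.isFactor_singleton a, rfl, rfl⟩, ?_⟩
    rintro p ⟨hlen, -, -, hp⟩
    obtain ⟨b, rfl⟩ := List.length_eq_one_iff.1 hlen
    simpa using hp
  | succ m ih =>
    obtain ⟨q, ⟨hlen, hf, hpal, hctr⟩, huniq⟩ := ih
    obtain ⟨c, hc⟩ := h.exists_surround hpal hf
    refine ⟨c :: q ++ [c], ⟨by simp; omega, hc, ?_, ?_⟩, ?_⟩
    · simp only [IsPalindrome] at hpal ⊢
      simp [hpal]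
    · rw [List.cons_append, List.getD_cons_succ, List.getD_append _ _ _ _ (by omega), hctr]
    · rintro (_ | ⟨d, p⟩) ⟨hplen, hpf, hppal, hpctr⟩
      · simp at hplen
      obtain rfl | ⟨p, e, rfl⟩ := p.eq_nil_or_concat'
      · simp at hplen
      have hl : p.length = 2 * m + 1 := by simp at hplen; omega
      simp only [IsPalindrome, List.reverse_cons, List.reverse_append, List.reverse_nil,
        List.nil_append, List.cons_append, List.cons.injEq] at hppal
      obtain ⟨rfl, hppal⟩ := hppal
      rw [List.getD_cons_succ, List.getD_append _ _ _ _ (by omega)] at hpctr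
      have hpq : p = q := huniq p ⟨hl, IsFactor.of_append_singleton hpf.of_cons,
        (List.append_inj' hppal rfl).1, hpctr⟩
      subst hpq
      rw [h.eq_of_isFactor_surround hpal hc hpf]
      rfl

end IsSturmian

end Sturmian

/-- A Sturmian sequence on `{0,1}` has, for every odd length `2m+1`, exactly
one palindromic factor with central letter `0` and exactly one with central
letter `1`. -/
theorem stmt9 (β : ℕ → Fin 2) (hst : ∀ k, 1 ≤ k → facComplexity β k = k + 1)
    (m : ℕ) :
    (∃! p : List (Fin 2), p.length = 2 * m + 1 ∧ IsFactor β p ∧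
      IsPalindrome p ∧ p.getD m 0 = 0) ∧
    (∃! p : List (Fin 2), p.length = 2 * m + 1 ∧ IsFactor β p ∧
      IsPalindrome p ∧ p.getD m 0 = 1) :=
  ⟨IsSturmian.existsUnique_palindrome hst 0 m, IsSturmian.existsUnique_palindrome hst 1 m⟩

end PalPaper
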